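/- Let λ > 0 be a real number. For every r ∈ ℕ and every n ∈ ℕ, the modified degenerate Hermite-based tangent polynomials satisfy _HT_n^{(r)}(x, y:λ) = ∑_{k=0}^{n} C(n,k) · _HT_k^{(r)}(1/2, 0:λ) · H_{n−k}(x − 1/2, y:λ), for all real x, y. -/

import Mathlib

open PowerSeries Finset

/-- The formal power series `e^{a t}`. -/
noncomputable def expX (a : ℝ) : PowerSeries ℝ :=
  PowerSeries.mk fun n => a ^ n / n.factorial

/-- The formal power series `e^{a t^2}`. -/
noncomputable def expX2 (a : ℝ) : PowerSeries ℝ :=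
  PowerSeries.mk fun n => if 2 ∣ n then a ^ (n / 2) / (n / 2).factorial else 0

/-- The formal power series `e^{x t + y t^2}`. -/
noncomputable def expH (x y : ℝ) : PowerSeries ℝ := expX x * expX2 y

theorem expX_eq_rescale_exp (a : ℝ) : expX a = rescale a (PowerSeries.exp ℝ) := by
  ext n
  simp [expX, coeff_rescale, coeff_exp, div_eq_mul_inv]

theorem expX_mul_expX (a b : ℝ) : expX a * expX b = expX (a + b) := by
  simp only [expX_eq_rescale_exp, exp_mul_exp_eq_exp_add]

theorem expX2_zero : expX2 0 = 1 := by
  ext n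
  rw [expX2, coeff_mk, coeff_one]
  rcases Nat.eq_zero_or_pos n with rfl | hn
  · simp
  · rw [if_neg hn.ne']
    split_ifs with h
    · obtain ⟨m, rfl⟩ := h
      have hm : m ≠ 0 := by omega
      simp [hm]
    · rfl

theorem expH_zero_mul_expH (a b y : ℝ) : expH a 0 * expH b y = expH (a + b) y := by
  simp only [expH, expX2_zero, mul_one, ← mul_assoc, expX_mul_expX]

theorem expX_add_one_ne_zero (a : ℝ) : expX a + 1 ≠ 0 := by
  intro h
  have h0 := congrArg (coeff 0) h
  norm_num [expX, coeff_mk] at h0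

/-- Coefficient comparison for a product of exponential generating functions. -/
theorem eq_sum_choose_of_mk_eq_mul {u v w : ℕ → ℝ}
    (h : (PowerSeries.mk fun n => u n / n.factorial) =
      (PowerSeries.mk fun n => v n / n.factorial) *
        (PowerSeries.mk fun n => w n / n.factorial)) (n : ℕ) :
    u n = ∑ k ∈ Finset.range (n + 1), (n.choose k : ℝ) * v k * w (n - k) := by
  have hn := congrArg (coeff n) h
  rw [coeff_mul, Finset.Nat.sum_antidiagonal_eq_sum_range_succ_mk] at hn
  simp only [coeff_mk] at hn
  rw [div_eq_iff (by positivity), Finset.sum_mul] at hn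
  rw [hn]
  refine Finset.sum_congr rfl fun k hk => ?_
  rw [Nat.cast_choose ℝ (Nat.lt_succ_iff.mp (Finset.mem_range.mp hk))]
  field_simp

/-- for λ > 0,
    `_HT_n^{(r)}(x,y:λ) = ∑_k C(n,k) _HT_k^{(r)}(1/2,0:λ) H_{n-k}(x-1/2,y:λ)`. -/
theorem modified_degenerate_hermite_tangent_half_shift
    (l : ℝ) (hl : 0 < l)
    (T : ℕ → ℕ → ℝ → ℝ → ℝ) (Hd : ℕ → ℝ → ℝ → ℝ)
    (hT : ∀ r : ℕ, ∀ x y : ℝ,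
      (PowerSeries.mk fun n => T r n x y / n.factorial) *
          (expX (2 * Real.log (1 + l) / l) + 1) ^ r
        = 2 ^ r * expH (x * Real.log (1 + l) / l) (y * Real.log (1 + l) / l))
    (hH : ∀ x y : ℝ,
      (PowerSeries.mk fun n => Hd n x y / n.factorial)
        = expH (x * Real.log (1 + l) / l) (y * Real.log (1 + l) / l))
    (r n : ℕ) (x y : ℝ) :
    T r n x y =
      ∑ k ∈ Finset.range (n + 1),
        (n.choose k : ℝ) * T r k (1 / 2) 0 * Hd (n - k) (x - 1 / 2) y := by
  refine eq_sum_choose_of_mk_eq_mul (u := fun n => T r n x y)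
    (v := fun k => T r k (1 / 2) 0) (w := fun k => Hd k (x - 1 / 2) y) ?_ n
  refine mul_right_cancel₀
    (pow_ne_zero r (expX_add_one_ne_zero (2 * Real.log (1 + l) / l))) ?_
  rw [hT, mul_right_comm, hT, hH, mul_assoc, zero_mul, zero_div, expH_zero_mul_expH]
  congr 2
  ring
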